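/- Let E be a butterfly from (N → S) to (M → R) and F a butterfly from (P → T) to (N → S). Form the fiber product F ×_S E over π' : F → S and the map E → S, and let F ⊕^N_S E be its quotient by the image of the monomorphism N → F ×_S E, n ↦ (ι'(n), κ(n)). Then the quotient F ⊕^N_S E carries a ring structure induced from the product ring structure on the fiber product, the image of N is a two-sided ideal of F ×_S E, and with structure maps κ''(p) = [(κ'(p), 0)], ι''(m) = [(0, ι(m))], π''[(f, e)] = the projection of f to T via F, j''[(f, e)] = j(e), the data form a bimodule butterfly from (P → T) to (M → R). -/

import Mathlib

/-- A bimodule structure: left and right actions of a ring `R` on an abelian group `M`. -/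
structure BimoduleStr (R : Type*) (M : Type*) [Ring R] [AddCommGroup M] where
  sl : R → M → M
  sr : M → R → M
  sl_add : ∀ r m m', sl r (m + m') = sl r m + sl r m'
  add_sl : ∀ r r' m, sl (r + r') m = sl r m + sl r' m
  mul_sl : ∀ r r' m, sl (r * r') m = sl r (sl r' m)
  one_sl : ∀ m, sl 1 m = m
  sr_add : ∀ m m' r, sr (m + m') r = sr m r + sr m' r
  add_sr : ∀ m r r', sr m (r + r') = sr m r + sr m r'
  mul_sr : ∀ m r r', sr m (r * r') = sr (sr m r) r'
  one_sr : ∀ m, sr m 1 = m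
  sl_sr : ∀ r m r', sl r (sr m r') = sr (sl r m) r'

/-- A crossed bimodule: an `R`-bimodule map `∂ : M → R` satisfying the Pfeiffer identity. -/
structure CrossedBimodule (R : Type*) (M : Type*) [Ring R] [AddCommGroup M] extends
    BimoduleStr R M where
  d : M →+ R
  d_sl : ∀ r m, d (sl r m) = r * d m
  d_sr : ∀ m r, d (sr m r) = d m * r
  pfeiffer : ∀ m m', sl (d m) m' = sr m (d m')

/-- A bimodule butterfly from the crossed bimodule `CS : N → S` to the crossed bimodule
`CR : M → R`, with centerpiece ring `E`: the NE-SW diagonal `0 → M → E → S → 0` is a ring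
extension, the NW-SE diagonal `N → E → R` is a complex with `j` a ring homomorphism, both
diagonals are compatible with the differentials, and the four compatibility conditions hold. -/
structure Butterfly {S N R M : Type*} [Ring S] [AddCommGroup N] [Ring R] [AddCommGroup M]
    (CS : CrossedBimodule S N) (CR : CrossedBimodule R M)
    (E : Type*) [Ring E] where
  ι : M →+ E
  π : E →+* S
  κ : N →+ E
  j : E →+* R
  ι_inj : Function.Injective ι
  π_surj : Function.Surjective π
  exact : ∀ e, π e = 0 ↔ ∃ m, ι m = e
  jκ : ∀ n, j (κ n) = 0
  πκ : ∀ n, π (κ n) = CS.d n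
  jι : ∀ m, j (ι m) = CR.d m
  compat₁ : ∀ m e, ι (CR.sr m (j e)) = ι m * e
  compat₂ : ∀ m e, ι (CR.sl (j e) m) = e * ι m
  compat₃ : ∀ n e, κ (CS.sr n (π e)) = κ n * e
  compat₄ : ∀ n e, κ (CS.sl (π e) n) = e * κ n

/-- The fiber product `F ×_S E` over `j' : F → S` and `π : E → S`, as a subring of `F × E`. -/
def bfFiber {S F E : Type*} [Ring S] [Ring F] [Ring E]
    (j' : F →+* S) (π : E →+* S) : Subring (F × E) where
  carrier := {p | j' p.1 = π p.2}
  mul_mem' := by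
    intro a b ha hb
    simp only [Set.mem_setOf_eq, Prod.fst_mul, Prod.snd_mul, map_mul] at *
    rw [ha, hb]
  one_mem' := by simp
  add_mem' := by
    intro a b ha hb
    simp only [Set.mem_setOf_eq, Prod.fst_add, Prod.snd_add, map_add] at *
    rw [ha, hb]
  zero_mem' := by simp
  neg_mem' := by
    intro a ha
    simp only [Set.mem_setOf_eq, Prod.fst_neg, Prod.snd_neg, map_neg] at *
    rw [ha]

theorem mem_bfFiber {S F E : Type*} [Ring S] [Ring F] [Ring E]
    (j' : F →+* S) (π : E →+* S) (p : F × E) :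
    p ∈ bfFiber j' π ↔ j' p.1 = π p.2 := Iff.rfl

variable {T P S N R M F E : Type*} [Ring T] [AddCommGroup P] [Ring S] [AddCommGroup N]
  [Ring R] [AddCommGroup M] [Ring F] [Ring E]
  {CT : CrossedBimodule T P} {CS : CrossedBimodule S N} {CR : CrossedBimodule R M}

/-- The monomorphism `n ↦ (ι'(n), κ(n))` into the fiber product `F ×_S E`. -/
def νhom (BF : Butterfly CT CS F) (BE : Butterfly CS CR E) :
    N →+ ↥(bfFiber BF.j BE.π) where
  toFun n := ⟨(BF.ι n, BE.κ n), by
    rw [mem_bfFiber, BF.jι, BE.πκ]⟩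
  map_zero' := by apply Subtype.ext; simp
  map_add' a b := by apply Subtype.ext; simp

/-- The map `m ↦ (0, ι(m))` into the fiber product. -/
def ιmapC (BF : Butterfly CT CS F) (BE : Butterfly CS CR E) :
    M →+ ↥(bfFiber BF.j BE.π) where
  toFun m := ⟨(0, BE.ι m), by
    rw [mem_bfFiber, map_zero]
    exact ((BE.exact _).2 ⟨m, rfl⟩).symm⟩
  map_zero' := by apply Subtype.ext; simp
  map_add' a b := by apply Subtype.ext; simp

/-- The map `p ↦ (κ'(p), 0)` into the fiber product. -/
def κmapC (BF : Butterfly CT CS F) (BE : Butterfly CS CR E) :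
    P →+ ↥(bfFiber BF.j BE.π) where
  toFun p := ⟨(BF.κ p, 0), by
    rw [mem_bfFiber, BF.jκ, map_zero]⟩
  map_zero' := by apply Subtype.ext; simp
  map_add' a b := by apply Subtype.ext; simp

/-- composition of bimodule butterflies.  Given a butterfly `E` from
`(N → S)` to `(M → R)` and a butterfly `F` from `(P → T)` to `(N → S)`, the image of
`N → F ×_S E`, `n ↦ (ι'(n), κ(n))`, is a two-sided ideal of the fiber product
`F ×_S E`; the quotient `F ⊕^N_S E` carries the induced ring structure, and with the
induced structure maps `κ''(p) = [(κ'(p), 0)]`, `ι''(m) = [(0, ι(m))]`, `π''[(f, e)] = π'(f)`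
and `j''[(f, e)] = j(e)` it is a bimodule butterfly from `(P → T)` to `(M → R)`. -/
theorem stmt18 (BF : Butterfly CT CS F) (BE : Butterfly CS CR E) :
    -- the image of `N` is a two-sided ideal of the fiber product
    (∀ (g : ↥(bfFiber BF.j BE.π)) (n : N),
      ∃ n₁ n₂ : N, g * νhom BF BE n = νhom BF BE n₁ ∧ νhom BF BE n * g = νhom BF BE n₂) ∧
    -- the quotient is a butterfly from `(P → T)` to `(M → R)`
    (∃ (mulQ : (↥(bfFiber BF.j BE.π) ⧸ (νhom BF BE).range) →
               (↥(bfFiber BF.j BE.π) ⧸ (νhom BF BE).range) →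
               (↥(bfFiber BF.j BE.π) ⧸ (νhom BF BE).range))
       (π'' : (↥(bfFiber BF.j BE.π) ⧸ (νhom BF BE).range) → T)
       (j'' : (↥(bfFiber BF.j BE.π) ⧸ (νhom BF BE).range) → R),
      -- the ring structure descends to the quotient
      (∀ g g' : ↥(bfFiber BF.j BE.π),
        mulQ (QuotientAddGroup.mk g) (QuotientAddGroup.mk g') = QuotientAddGroup.mk (g * g')) ∧
      (∀ q q' q'', mulQ (mulQ q q') q'' = mulQ q (mulQ q' q'')) ∧
      (∀ q, mulQ (QuotientAddGroup.mk 1) q = q) ∧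
      (∀ q, mulQ q (QuotientAddGroup.mk 1) = q) ∧
      (∀ q q' q'', mulQ q (q' + q'') = mulQ q q' + mulQ q q'') ∧
      (∀ q q' q'', mulQ (q + q') q'' = mulQ q q'' + mulQ q' q'') ∧
      -- `π''` and `j''` are well defined ring homomorphisms
      (∀ g : ↥(bfFiber BF.j BE.π), π'' (QuotientAddGroup.mk g) = BF.π g.val.1) ∧
      (∀ q q', π'' (mulQ q q') = π'' q * π'' q') ∧ (∀ q q', π'' (q + q') = π'' q + π'' q') ∧
      (∀ g : ↥(bfFiber BF.j BE.π), j'' (QuotientAddGroup.mk g) = BE.j g.val.2) ∧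
      (∀ q q', j'' (mulQ q q') = j'' q * j'' q') ∧ (∀ q q', j'' (q + q') = j'' q + j'' q') ∧
      -- the NE-SW diagonal `0 → M → F ⊕^N_S E → T → 0` is exact
      Function.Injective (fun m : M => (QuotientAddGroup.mk (ιmapC BF BE m) :
        ↥(bfFiber BF.j BE.π) ⧸ (νhom BF BE).range)) ∧
      (∀ g : ↥(bfFiber BF.j BE.π), BF.π g.val.1 = 0 ↔
        ∃ m : M, (QuotientAddGroup.mk (ιmapC BF BE m) :
          ↥(bfFiber BF.j BE.π) ⧸ (νhom BF BE).range) = QuotientAddGroup.mk g) ∧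
      (∀ t : T, ∃ g : ↥(bfFiber BF.j BE.π), BF.π g.val.1 = t) ∧
      -- the NW-SE diagonal `P → F ⊕^N_S E → R` is a complex compatible with differentials
      (∀ p : P, j'' (QuotientAddGroup.mk (κmapC BF BE p)) = 0) ∧
      (∀ p : P, π'' (QuotientAddGroup.mk (κmapC BF BE p)) = CT.d p) ∧
      (∀ m : M, j'' (QuotientAddGroup.mk (ιmapC BF BE m)) = CR.d m) ∧
      -- the four butterfly compatibility conditions
      (∀ (m : M) (g : ↥(bfFiber BF.j BE.π)),
        mulQ (QuotientAddGroup.mk (ιmapC BF BE m)) (QuotientAddGroup.mk g)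
          = QuotientAddGroup.mk (ιmapC BF BE (CR.sr m (BE.j g.val.2)))) ∧
      (∀ (m : M) (g : ↥(bfFiber BF.j BE.π)),
        mulQ (QuotientAddGroup.mk g) (QuotientAddGroup.mk (ιmapC BF BE m))
          = QuotientAddGroup.mk (ιmapC BF BE (CR.sl (BE.j g.val.2) m))) ∧
      (∀ (p : P) (g : ↥(bfFiber BF.j BE.π)),
        mulQ (QuotientAddGroup.mk (κmapC BF BE p)) (QuotientAddGroup.mk g)
          = QuotientAddGroup.mk (κmapC BF BE (CT.sr p (BF.π g.val.1)))) ∧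
      (∀ (p : P) (g : ↥(bfFiber BF.j BE.π)),
        mulQ (QuotientAddGroup.mk g) (QuotientAddGroup.mk (κmapC BF BE p))
          = QuotientAddGroup.mk (κmapC BF BE (CT.sl (BF.π g.val.1) p)))) := by
  have hid : ∀ (g : ↥(bfFiber BF.j BE.π)) (n : N),
      g * νhom BF BE n = νhom BF BE (CS.sl (BF.j g.val.1) n) ∧
      νhom BF BE n * g = νhom BF BE (CS.sr n (BF.j g.val.1)) := by
    rintro ⟨⟨f, e⟩, h⟩ n
    have h' : BF.j f = BE.π e := h
    constructor
    · apply Subtype.ext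
      apply Prod.ext
      · exact (BF.compat₂ n f).symm
      · change e * BE.κ n = BE.κ (CS.sl (BF.j f) n)
        rw [h', BE.compat₄]
    · apply Subtype.ext
      apply Prod.ext
      · exact (BF.compat₁ n f).symm
      · change BE.κ n * e = BE.κ (CS.sr n (BF.j f))
        rw [h', BE.compat₃]
  have hmul : ∀ a a' b b' : ↥(bfFiber BF.j BE.π), -a + a' ∈ (νhom BF BE).range →
      -b + b' ∈ (νhom BF BE).range → -(a * b) + a' * b' ∈ (νhom BF BE).range := by
    rintro a a' b b' ⟨n, hn⟩ ⟨k, hk⟩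
    have h1 : -(a * b) + a' * b' = (-a + a') * b' + a * (-b + b') := by noncomm_ring
    rw [h1, ← hn, ← hk, (hid b' n).2, (hid a k).1]
    exact add_mem ⟨_, rfl⟩ ⟨_, rfl⟩
  have hπ : ∀ a a' : ↥(bfFiber BF.j BE.π), -a + a' ∈ (νhom BF BE).range →
      BF.π a.val.1 = BF.π a'.val.1 := by
    rintro a a' ⟨n, hn⟩
    have h1 : BF.ι n = -a.val.1 + a'.val.1 := congrArg (fun x => x.val.1) hn
    have h2 := (BF.exact _).2 ⟨n, h1⟩
    rw [map_add, map_neg] at h2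
    exact neg_add_eq_zero.1 h2
  have hj : ∀ a a' : ↥(bfFiber BF.j BE.π), -a + a' ∈ (νhom BF BE).range →
      BE.j a.val.2 = BE.j a'.val.2 := by
    rintro a a' ⟨n, hn⟩
    have h1 : BE.κ n = -a.val.2 + a'.val.2 := congrArg (fun x => x.val.2) hn
    have h2 := BE.jκ n
    rw [h1, map_add, map_neg] at h2
    exact neg_add_eq_zero.1 h2
  refine ⟨fun g n => ⟨_, _, hid g n⟩, ?_⟩
  refine ⟨Quotient.map₂ (fun a b => a * b) ?_, Quotient.lift (fun a => BF.π a.val.1) ?_,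
    Quotient.lift (fun a => BE.j a.val.2) ?_, ?_⟩
  · intro a a' ha b b' hb
    exact QuotientAddGroup.leftRel_apply.2
      (hmul _ _ _ _ (QuotientAddGroup.leftRel_apply.1 ha) (QuotientAddGroup.leftRel_apply.1 hb))
  · intro a a' ha
    exact hπ _ _ (QuotientAddGroup.leftRel_apply.1 ha)
  · intro a a' ha
    exact hj _ _ (QuotientAddGroup.leftRel_apply.1 ha)
  refine ⟨fun _ _ => rfl, ?_, ?_, ?_, ?_, ?_, fun _ => rfl, ?_, ?_, fun _ => rfl, ?_, ?_, ?_, ?_,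
    ?_, ?_, ?_, ?_, ?_, ?_, ?_, ?_⟩
  · rintro ⟨a⟩ ⟨b⟩ ⟨c⟩
    exact congrArg QuotientAddGroup.mk (mul_assoc a b c)
  · rintro ⟨a⟩
    exact congrArg QuotientAddGroup.mk (one_mul a)
  · rintro ⟨a⟩
    exact congrArg QuotientAddGroup.mk (mul_one a)
  · rintro ⟨a⟩ ⟨b⟩ ⟨c⟩
    exact congrArg QuotientAddGroup.mk (mul_add a b c)
  · rintro ⟨a⟩ ⟨b⟩ ⟨c⟩
    exact congrArg QuotientAddGroup.mk (add_mul a b c)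
  · rintro ⟨a⟩ ⟨b⟩
    exact map_mul BF.π a.val.1 b.val.1
  · rintro ⟨a⟩ ⟨b⟩
    exact map_add BF.π a.val.1 b.val.1
  · rintro ⟨a⟩ ⟨b⟩
    exact map_mul BE.j a.val.2 b.val.2
  · rintro ⟨a⟩ ⟨b⟩
    exact map_add BE.j a.val.2 b.val.2
  · intro m m' h
    obtain ⟨n, hn⟩ := QuotientAddGroup.eq.1 h
    have h1 : BF.ι n = -0 + 0 := congrArg (fun x => x.val.1) hn
    have h2 : BE.κ n = -BE.ι m + BE.ι m' := congrArg (fun x => x.val.2) hn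
    have h3 : n = 0 := BF.ι_inj (by rw [h1]; simp)
    rw [h3, map_zero] at h2
    exact BE.ι_inj (neg_add_eq_zero.1 h2.symm)
  · rintro g
    constructor
    · intro hg
      obtain ⟨n, hn⟩ := (BF.exact _).1 hg
      have hm : BF.j g.val.1 = BE.π g.val.2 := g.property
      have h0 : BE.π (g.val.2 - BE.κ n) = 0 := by
        rw [map_sub, ← hm, ← hn, BF.jι, BE.πκ, sub_self]
      obtain ⟨m, hm'⟩ := (BE.exact _).1 h0
      refine ⟨m, QuotientAddGroup.eq.2 ⟨n, ?_⟩⟩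
      apply Subtype.ext
      apply Prod.ext
      · change BF.ι n = -0 + g.val.1
        rw [hn]; simp
      · change BE.κ n = -BE.ι m + g.val.2
        rw [hm']; abel
    · rintro ⟨m, hm⟩
      rw [← hπ _ _ (QuotientAddGroup.eq.1 hm)]
      exact map_zero BF.π
  · intro t
    obtain ⟨f, hf⟩ := BF.π_surj t
    obtain ⟨e, he⟩ := BE.π_surj (BF.j f)
    exact ⟨⟨(f, e), he.symm⟩, hf⟩
  · intro p
    exact map_zero BE.j
  · intro p
    exact BF.πκ p
  · intro m
    exact BE.jι m
  · intro m g
    refine congrArg QuotientAddGroup.mk (Subtype.ext (Prod.ext ?_ ?_))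
    · exact zero_mul g.val.1
    · exact (BE.compat₁ m g.val.2).symm
  · intro m g
    refine congrArg QuotientAddGroup.mk (Subtype.ext (Prod.ext ?_ ?_))
    · exact mul_zero g.val.1
    · exact (BE.compat₂ m g.val.2).symm
  · intro p g
    refine congrArg QuotientAddGroup.mk (Subtype.ext (Prod.ext ?_ ?_))
    · exact (BF.compat₃ p g.val.1).symm
    · exact zero_mul g.val.2
  · intro p g
    refine congrArg QuotientAddGroup.mk (Subtype.ext (Prod.ext ?_ ?_))
    · exact (BF.compat₄ p g.val.1).symm
    · exact mul_zero g.val.2
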